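/- arXiv:1909.02773 — 9 statements merged into one kernel-verified Lean document; each statement's English description precedes it below -/
import Mathlib

section
/- If E_G is nonempty, then the Krull dimension of the quotient ring K[E_G]/I(X_G) equals 1. -/
open MvPolynomial

/-- The polynomial `x_i * x_j` associated to an edge `e = {i, j}`. -/
noncomputable def edgePoly {V : Type} (K : Type) [CommRing K] (e : Sym2 V) :
    MvPolynomial V K :=
  Sym2.lift ⟨fun i j => X i * X j, fun _ _ => mul_comm _ _⟩ e

/-- The map `θ : K[E_G] → K[V_G]`, sending `t_e` to `x_i * x_j` for `e = {i, j}`. -/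
noncomputable def thetaG {V : Type} (K : Type) [CommRing K] (G : SimpleGraph V) :
    MvPolynomial G.edgeSet K →ₐ[K] MvPolynomial V K :=
  aeval fun e => edgePoly K (e : Sym2 V)

/-- The ideal `J_V = (x_i² - x_j² : i, j ∈ V)` of `K[V_G]`. -/
noncomputable def JV (V K : Type) [CommRing K] : Ideal (MvPolynomial V K) :=
  Ideal.span {f | ∃ i j : V, f = X i ^ 2 - X j ^ 2}

/-- The ideal `I(X_G) = θ⁻¹(J_V)` of `K[E_G]`. -/
noncomputable def IX {V : Type} (K : Type) [CommRing K] (G : SimpleGraph V) :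
    Ideal (MvPolynomial G.edgeSet K) :=
  Ideal.comap (thetaG K G) (JV V K)

/-- An integral extension does not raise the Krull dimension. -/
theorem ringKrullDim_le_of_isIntegral (R S : Type*) [CommRing R] [CommRing S] [Algebra R S]
    [Algebra.IsIntegral R S] : ringKrullDim S ≤ ringKrullDim R :=
  Order.krullDim_le_of_strictMono (PrimeSpectrum.comap (algebraMap R S)) fun _ _ h =>
    Ideal.IsIntegral.comap_lt_comap h

theorem ringKrullDim_polynomial_field (K : Type*) [Field K] :
    ringKrullDim (Polynomial K) = 1 :=
  IsPrincipalIdealRing.ringKrullDim_eq_one _ (Polynomial.not_isField K)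

section

variable {V K : Type}

theorem mk_JV_X_sq [CommRing K] (i j : V) :
    Ideal.Quotient.mk (JV V K) (X i) ^ 2 = Ideal.Quotient.mk (JV V K) (X j) ^ 2 := by
  rw [← map_pow, ← map_pow, Ideal.Quotient.eq]
  exact Ideal.subset_span ⟨i, j, rfl⟩

theorem mk_JV_edgePoly_sq [CommRing K] (e f : Sym2 V) :
    Ideal.Quotient.mk (JV V K) (edgePoly K e) ^ 2 =
      Ideal.Quotient.mk (JV V K) (edgePoly K f) ^ 2 := by
  induction e with
  | _ i j =>
  induction f with
  | _ k l =>
  simp only [edgePoly, Sym2.lift_mk, map_mul, mul_pow]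
  rw [mk_JV_X_sq i k, mk_JV_X_sq j l]

theorem mk_IX_X_sq [CommRing K] (G : SimpleGraph V) (e f : G.edgeSet) :
    Ideal.Quotient.mk (IX K G) (X e) ^ 2 = Ideal.Quotient.mk (IX K G) (X f) ^ 2 := by
  rw [← map_pow, ← map_pow, Ideal.Quotient.eq, IX, Ideal.mem_comap, map_sub, ← Ideal.Quotient.eq]
  simpa [thetaG] using mk_JV_edgePoly_sq (K := K) (e : Sym2 V) (f : Sym2 V)

theorem aeval_X_eq_zero_of_mem_JV [CommRing K] {f : MvPolynomial V K} (hf : f ∈ JV V K) :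
    aeval (fun _ => (Polynomial.X : Polynomial K)) f = 0 := by
  have h : JV V K ≤ RingHom.ker (aeval fun _ : V => (Polynomial.X : Polynomial K)) := by
    refine Ideal.span_le.mpr ?_
    rintro _ ⟨i, j, rfl⟩
    simp [RingHom.mem_ker]
  exact h hf

theorem aeval_X_thetaG [CommRing K] (G : SimpleGraph V) (q : MvPolynomial G.edgeSet K) :
    aeval (fun _ => (Polynomial.X : Polynomial K)) (thetaG K G q) =
      Polynomial.expand K 2 (aeval (fun _ => Polynomial.X) q) := by
  suffices h : (aeval fun _ => (Polynomial.X : Polynomial K)).comp (thetaG K G) =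
      (Polynomial.expand K 2).comp (aeval fun _ => Polynomial.X) from DFunLike.congr_fun h q
  ext1 e
  obtain ⟨e, he⟩ := e
  induction e with
  | _ i j => simp [thetaG, edgePoly, sq]

theorem aeval_X_eq_zero_of_mem_IX [CommRing K] {G : SimpleGraph V}
    {q : MvPolynomial G.edgeSet K} (hq : q ∈ IX K G) :
    aeval (fun _ => (Polynomial.X : Polynomial K)) q = 0 :=
  (Polynomial.expand_eq_zero two_pos).mp <|
    (aeval_X_thetaG G q).symm.trans (aeval_X_eq_zero_of_mem_JV hq)

theorem one_le_ringKrullDim_quotient_IX [Field K] (G : SimpleGraph V) (e : G.edgeSet) :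
    1 ≤ ringKrullDim (MvPolynomial G.edgeSet K ⧸ IX K G) := by
  rw [← ringKrullDim_polynomial_field K]
  let φ : MvPolynomial G.edgeSet K →ₐ[K] Polynomial K := aeval fun _ => Polynomial.X
  refine ringKrullDim_le_of_surjective
    (Ideal.Quotient.lift (IX K G) φ.toRingHom fun _ hq => aeval_X_eq_zero_of_mem_IX hq)
    (Ideal.Quotient.lift_surjective_of_surjective _ _ fun p => ⟨Polynomial.aeval (X e) p, ?_⟩)
  change φ (Polynomial.aeval (X e) p) = p
  simp [φ, ← Polynomial.aeval_algHom_apply]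

theorem ringKrullDim_quotient_IX_le_one [Field K] (G : SimpleGraph V) (e : G.edgeSet) :
    ringKrullDim (MvPolynomial G.edgeSet K ⧸ IX K G) ≤ 1 := by
  rw [← ringKrullDim_polynomial_field K]
  let t : MvPolynomial G.edgeSet K ⧸ IX K G := Ideal.Quotient.mk (IX K G) (X e)
  let := (Polynomial.aeval (R := K) t).toRingHom.toAlgebra
  have hX : algebraMap (Polynomial K) (MvPolynomial G.edgeSet K ⧸ IX K G) Polynomial.X = t :=
    Polynomial.aeval_X t
  have hC (c : K) : algebraMap (Polynomial K) (MvPolynomial G.edgeSet K ⧸ IX K G)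
      (Polynomial.C c) = Ideal.Quotient.mk (IX K G) (C c) := Polynomial.aeval_C t c
  have : Algebra.IsIntegral (Polynomial K) (MvPolynomial G.edgeSet K ⧸ IX K G) := by
    refine ⟨fun a => ?_⟩
    obtain ⟨q, rfl⟩ := Ideal.Quotient.mk_surjective a
    induction q using MvPolynomial.induction_on with
    | C c => exact hC c ▸ isIntegral_algebraMap
    | add p q hp hq => exact map_add (Ideal.Quotient.mk (IX K G)) p q ▸ hp.add hq
    | mul_X p f hp =>
      rw [map_mul]
      refine hp.mul (IsIntegral.of_pow two_pos ?_)
      rw [mk_IX_X_sq G f e]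
      exact (hX ▸ isIntegral_algebraMap : IsIntegral (Polynomial K) t).pow 2
  exact ringKrullDim_le_of_isIntegral _ _

end

/-- If `E_G` is nonempty, the Krull dimension of `K[E_G]/I(X_G)` equals `1`. -/
theorem stmt2 {V K : Type} [Fintype V] [Field K] (G : SimpleGraph V)
    (hG : ∀ v : V, ∃ w : V, G.Adj v w) (hE : G.edgeSet.Nonempty) :
    ringKrullDim (MvPolynomial G.edgeSet K ⧸ IX K G) = 1 := by
  obtain ⟨e, he⟩ := hE
  exact le_antisymm (ringKrullDim_quotient_IX_le_one G ⟨e, he⟩)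
    (one_le_ringKrullDim_quotient_IX G ⟨e, he⟩)
end

section
/- For every nonzero exponent vector δ ∈ ℕ^{E_G} and every f ∈ K[E_G], if t^δ·f ∈ I(X_G) then f ∈ I(X_G); that is, every nonconstant monomial of K[E_G] is a nonzerodivisor on the quotient K[E_G]/I(X_G). -/
open MvPolynomial

/-- The degree of an exponent vector together with its class modulo `2`. -/
def degParity (V : Type) [Fintype V] : (V →₀ ℕ) →+ ℤ × (V → ZMod 2) where
  toFun a := (∑ i, (a i : ℤ), fun i => (a i : ZMod 2))
  map_zero' := by ext <;> simp
  map_add' a b := by ext <;> simp [Finset.sum_add_distrib]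

/-- The `K`-algebra homomorphism sending the monomial `x^a` to the group element `degParity a`. -/
noncomputable def parityHom (V K : Type) [Fintype V] [Field K] :
    MvPolynomial V K →ₐ[K] AddMonoidAlgebra K (ℤ × (V → ZMod 2)) :=
  aeval fun i => AddMonoidAlgebra.single (degParity V (Finsupp.single i 1)) 1

lemma parityHom_monomial {V K : Type} [Fintype V] [Field K] (a : V →₀ ℕ) (c : K) :
    parityHom V K (monomial a c) = AddMonoidAlgebra.single (degParity V a) c := by
  induction a using Finsupp.induction_linear generalizing c with
  | zero =>
    rw [map_zero, ← C_apply, ← algebraMap_eq, AlgHom.commutes]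
    rfl
  | add a b ha hb =>
    rw [← mul_one c, ← monomial_mul, map_mul, ha, hb, AddMonoidAlgebra.single_mul_single, map_add]
  | single i n =>
    rw [monomial_eq, map_mul, ← algebraMap_eq, AlgHom.commutes,
      Finsupp.prod_single_index (h := fun k e => X k ^ e) (pow_zero _), map_pow, parityHom, aeval_X,
      AddMonoidAlgebra.single_pow, ← map_nsmul, Finsupp.smul_single, one_pow, smul_eq_mul, mul_one]
    simp [AddMonoidAlgebra.single_mul_single]

lemma JV_le_ker_parityHom {V K : Type} [Fintype V] [Field K] {f : MvPolynomial V K}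
    (hf : f ∈ JV V K) : parityHom V K f = 0 := by
  suffices h : JV V K ≤ RingHom.ker (parityHom V K) from h hf
  refine Ideal.span_le.mpr ?_
  rintro _ ⟨i, j, rfl⟩
  classical
  have hdeg (k : V) : degParity V (Finsupp.single k 2) = (2, 0) := by
    ext l
    · simp [degParity, Finsupp.single_apply]
    · by_cases hkl : k = l
      · simp only [degParity, AddMonoidHom.coe_mk, ZeroHom.coe_mk, hkl, Finsupp.single_eq_same]
        rfl
      · simp [degParity, Finsupp.single_apply, hkl]
  simp only [SetLike.mem_coe, RingHom.mem_ker, X_pow_eq_monomial, map_sub, parityHom_monomial,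
    hdeg, sub_self]

lemma mk_monomial_eq {V K : Type} [Fintype V] [Field K] (k : V) (a : V →₀ ℕ) :
    Ideal.Quotient.mk (JV V K) (monomial a 1) =
      Ideal.Quotient.mk (JV V K) (X k) ^ (2 * ∑ i, a i / 2) *
        ∏ i, Ideal.Quotient.mk (JV V K) (X i) ^ (a i % 2) := by
  have hsq (i : V) : Ideal.Quotient.mk (JV V K) (X i) ^ 2 =
      Ideal.Quotient.mk (JV V K) (X k) ^ 2 := by
    rw [← map_pow, ← map_pow]
    exact Ideal.Quotient.eq.mpr (Ideal.subset_span ⟨i, k, rfl⟩)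
  rw [monomial_eq, C_1, one_mul, Finsupp.prod_fintype _ _ fun _ => pow_zero _, map_prod, pow_mul,
    ← Finset.prod_pow_eq_pow_sum, ← Finset.prod_mul_distrib]
  refine Finset.prod_congr rfl fun i _ => ?_
  rw [map_pow, ← hsq i, ← pow_mul, ← pow_add, Nat.div_add_mod]

lemma mk_monomial_eq_of_degParity_eq {V K : Type} [Fintype V] [Field K] {a b : V →₀ ℕ}
    (h : degParity V a = degParity V b) :
    Ideal.Quotient.mk (JV V K) (monomial a 1) = Ideal.Quotient.mk (JV V K) (monomial b 1) := by
  rcases isEmpty_or_nonempty V with _ | ⟨⟨k⟩⟩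
  · rw [Subsingleton.elim a b]
  have hmod (i : V) : a i % 2 = b i % 2 :=
    (ZMod.natCast_eq_natCast_iff' _ _ _).mp (congrFun (congrArg Prod.snd h) i)
  have hsum : ∑ i, a i = ∑ i, b i := by
    have := congrArg Prod.fst h
    simp only [degParity, AddMonoidHom.coe_mk, ZeroHom.coe_mk] at this
    exact_mod_cast this
  have hsplit (c : V →₀ ℕ) : ∑ i, c i = 2 * ∑ i, c i / 2 + ∑ i, c i % 2 := by
    rw [Finset.mul_sum, ← Finset.sum_add_distrib]
    exact Finset.sum_congr rfl fun i _ => (Nat.div_add_mod _ _).symm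
  have hdiv : 2 * ∑ i, a i / 2 = 2 * ∑ i, b i / 2 := by
    have ha := hsplit a
    have hb := hsplit b
    simp only [hmod] at ha
    omega
  rw [mk_monomial_eq k a, mk_monomial_eq k b, hdiv]
  simp only [hmod]

lemma mem_JV_of_parityHom_eq_zero {V K : Type} [Fintype V] [Field K] {f : MvPolynomial V K}
    (hf : parityHom V K f = 0) : f ∈ JV V K := by
  let s : ℤ × (V → ZMod 2) → MvPolynomial V K ⧸ JV V K := fun m =>
    Ideal.Quotient.mk (JV V K) (monomial (Function.invFun (degParity V) m) 1)
  let ψ : AddMonoidAlgebra K (ℤ × (V → ZMod 2)) →ₗ[K] MvPolynomial V K ⧸ JV V K :=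
    Finsupp.linearCombination K s ∘ₗ (AddMonoidAlgebra.coeffLinearEquiv K).toLinearMap
  have hψ : ψ ∘ₗ (parityHom V K).toLinearMap = (Ideal.Quotient.mkₐ K (JV V K)).toLinearMap := by
    refine (basisMonomials V K).ext fun a => ?_
    have hs : s (degParity V a) = Ideal.Quotient.mk (JV V K) (monomial a 1) :=
      mk_monomial_eq_of_degParity_eq (Function.invFun_eq ⟨a, rfl⟩)
    simp [parityHom_monomial, ψ, hs, coe_basisMonomials]
  have := LinearMap.congr_fun hψ f
  simp only [LinearMap.comp_apply, AlgHom.toLinearMap_apply, hf, map_zero] at this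
  exact Ideal.Quotient.eq_zero_iff_mem.mp this.symm

lemma isUnit_parityHom_edgePoly {V K : Type} [Fintype V] [Field K] (e : Sym2 V) :
    IsUnit (parityHom V K (edgePoly K e)) := by
  have hX (i : V) : IsUnit (parityHom V K (X i)) := by
    rw [parityHom, aeval_X]
    refine IsUnit.of_mul_eq_one
      (AddMonoidAlgebra.single (-degParity V (Finsupp.single i 1)) 1) ?_
    rw [AddMonoidAlgebra.single_mul_single, add_neg_cancel, mul_one]
    rfl
  induction e with
  | _ i j =>
    rw [edgePoly, Sym2.lift_mk, map_mul]
    exact (hX i).mul (hX j)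

/-- Every nonconstant monomial `t^δ` is a nonzerodivisor on `K[E_G]/I(X_G)`:
if `t^δ · f ∈ I(X_G)` then `f ∈ I(X_G)`. -/
theorem stmt3 {V K : Type} [Fintype V] [Field K] (G : SimpleGraph V)
    (hG : ∀ v : V, ∃ w : V, G.Adj v w)
    (δ : G.edgeSet →₀ ℕ) (hδ : δ ≠ 0) (f : MvPolynomial G.edgeSet K)
    (h : monomial δ (1 : K) * f ∈ IX K G) : f ∈ IX K G := by
  have hu : IsUnit (parityHom V K (thetaG K G (monomial δ 1))) := by
    rw [thetaG, aeval_monomial, map_one, one_mul, Finsupp.prod, map_prod]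
    refine (IsUnit.prod_iff).mpr fun e _ => ?_
    rw [map_pow]
    exact (isUnit_parityHom_edgePoly _).pow _
  have hmem : thetaG K G (monomial δ 1 * f) ∈ JV V K := h
  have hzero := JV_le_ker_parityHom hmem
  rw [map_mul, map_mul, hu.mul_right_eq_zero] at hzero
  exact mem_JV_of_parityHom_eq_zero hzero
end

section
/- For every index k and every polynomial g ∈ K[x_1,…,x_n], if x_k·g belongs to the ideal generated by {x_i² − x_j² : 1 ≤ i, j ≤ n}, then g belongs to that ideal; that is, each variable x_k is a nonzerodivisor on K[x_1,…,x_n]/(x_i² − x_j² : i, j). -/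
open MvPolynomial

/-- The parities of the exponents of a monomial, together with its total degree. -/
def parityDegree (V : Type) [Fintype V] : (V →₀ ℕ) →+ (V → ZMod 2) × ℤ where
  toFun m := (fun i => (m i : ZMod 2), ∑ i, (m i : ℤ))
  map_zero' := by ext <;> simp
  map_add' a b := by ext <;> simp [Finset.sum_add_distrib]

/-- The grading of polynomials by parities and degree, as a map to a group algebra. -/
noncomputable def parityDegreeHom (V K : Type) [Fintype V] [CommRing K] :
    MvPolynomial V K →+* AddMonoidAlgebra K ((V → ZMod 2) × ℤ) :=
  AddMonoidAlgebra.mapDomainRingHom K (parityDegree V)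

lemma parityDegreeHom_monomial {V K : Type} [Fintype V] [CommRing K] (m : V →₀ ℕ) (c : K) :
    parityDegreeHom V K (monomial m c) = AddMonoidAlgebra.single (parityDegree V m) c :=
  AddMonoidAlgebra.mapDomain_single

lemma isUnit_parityDegreeHom_X {V K : Type} [Fintype V] [CommRing K] (k : V) :
    IsUnit (parityDegreeHom V K (X k)) := by
  rw [X, parityDegreeHom_monomial]
  refine IsUnit.of_mul_eq_one
    (AddMonoidAlgebra.single (-parityDegree V (Finsupp.single k 1)) 1) ?_
  rw [AddMonoidAlgebra.single_mul_single, add_neg_cancel, one_mul, AddMonoidAlgebra.one_def]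

lemma JV_le_ker_parityDegreeHom (V K : Type) [Fintype V] [CommRing K] :
    JV V K ≤ RingHom.ker (parityDegreeHom V K) := by
  classical
  refine Ideal.span_le.2 ?_
  rintro _ ⟨i, j, rfl⟩
  have key (i : V) : parityDegree V (Finsupp.single i 2) = (0, 2) := by
    ext l
    · by_cases h : i = l
      · subst h
        simp [parityDegree]
        rfl
      · simp [parityDegree, Finsupp.single_apply, h]
    · simp [parityDegree, Finsupp.single_apply]
  simp only [SetLike.mem_coe, RingHom.mem_ker, map_sub, X_pow_eq_monomial,
    parityDegreeHom_monomial, key, sub_self]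

/-- The normal form modulo `JV V K` of monomials with given parities and degree. -/
noncomputable def normalForm {V : Type} (K : Type) [Fintype V] [CommRing K] (k : V)
    (a : (V → ZMod 2) × ℤ) : MvPolynomial V K ⧸ JV V K :=
  Ideal.Quotient.mk _
    ((X k ^ 2) ^ ((a.2 - ∑ i, ((a.1 i).val : ℤ)) / 2).toNat * ∏ i, X i ^ (a.1 i).val)

lemma normalForm_parityDegree {V K : Type} [Fintype V] [CommRing K] (k : V) (m : V →₀ ℕ) :
    normalForm K k (parityDegree V m) = Ideal.Quotient.mk (JV V K) (monomial m 1) := by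
  have hsq (i : V) : Ideal.Quotient.mk (JV V K) (X i) ^ 2
      = Ideal.Quotient.mk (JV V K) (X k) ^ 2 := by
    rw [← map_pow, ← map_pow]
    exact Ideal.Quotient.eq.2 (Ideal.subset_span ⟨i, k, rfl⟩)
  have hexp : ((∑ i, (m i : ℤ) - ∑ i, ((m i % 2 : ℕ) : ℤ)) / 2).toNat = ∑ i, m i / 2 := by
    have h : ∑ i, (m i : ℤ) - ∑ i, ((m i % 2 : ℕ) : ℤ) = 2 * ((∑ i, m i / 2 : ℕ) : ℤ) := by
      rw [← Finset.sum_sub_distrib, Nat.cast_sum, Finset.mul_sum]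
      exact Finset.sum_congr rfl fun i _ => by omega
    rw [h]
    omega
  rw [monomial_eq, Finsupp.prod_fintype _ _ fun i => pow_zero _]
  simp only [normalForm, parityDegree, AddMonoidHom.coe_mk, ZeroHom.coe_mk, ZMod.val_natCast,
    hexp, map_mul, map_pow, map_prod, map_one, one_mul]
  rw [← Finset.prod_pow_eq_pow_sum, ← Finset.prod_mul_distrib]
  refine Finset.prod_congr rfl fun i _ => ?_
  rw [← hsq i, ← pow_mul, ← pow_add, Nat.div_add_mod]

lemma ker_parityDegreeHom_le_JV {V K : Type} [Fintype V] [CommRing K] (k : V) :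
    RingHom.ker (parityDegreeHom V K) ≤ JV V K := by
  intro g hg
  let retraction : AddMonoidAlgebra K ((V → ZMod 2) × ℤ) →+ MvPolynomial V K ⧸ JV V K :=
    (Finsupp.liftAddHom fun a => (AddMonoidHom.mulRight (normalForm K k a)).comp
      (algebraMap K (MvPolynomial V K ⧸ JV V K)).toAddMonoidHom).comp
      AddMonoidAlgebra.coeffAddEquiv.toAddMonoidHom
  have hcomp : retraction.comp (parityDegreeHom V K).toAddMonoidHom
      = (Ideal.Quotient.mk (JV V K)).toAddMonoidHom := by
    refine AddMonoidAlgebra.addMonoidHom_ext fun m c => ?_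
    have hr : retraction (parityDegreeHom V K (monomial m c))
        = algebraMap K _ c * normalForm K k (parityDegree V m) := by
      rw [parityDegreeHom_monomial]
      simp [retraction]
    refine hr.trans ?_
    rw [normalForm_parityDegree]
    change Ideal.Quotient.mk _ (C c) * _ = _
    rw [← map_mul, C_mul_monomial, mul_one]
    rfl
  have h := DFunLike.congr_fun hcomp g
  refine Ideal.Quotient.eq_zero_iff_mem.1 (h.symm.trans ?_)
  change retraction (parityDegreeHom V K g) = 0
  rw [RingHom.mem_ker.1 hg, map_zero]

/-- Each variable `x_k` is a nonzerodivisor on `K[x_1, …, x_n]/(x_i² - x_j² : i, j)`: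
if `x_k · g` lies in the ideal generated by the differences of squares of variables,
then so does `g`. -/
theorem stmt4 {K : Type} [Field K] (n : ℕ) (hn : 1 ≤ n) (k : Fin n)
    (g : MvPolynomial (Fin n) K)
    (h : X k * g ∈ JV (Fin n) K) : g ∈ JV (Fin n) K := by
  refine ker_parityDegreeHom_le_JV k (RingHom.mem_ker.2 ?_)
  have hker := RingHom.mem_ker.1 (JV_le_ker_parityDegreeHom _ _ h)
  rw [map_mul] at hker
  exact (isUnit_parityDegreeHom_X k).mul_right_eq_zero.1 hker
end

section
/- Let δ, γ ∈ ℕ^{V_G} with Σ_i δ(i) = Σ_i γ(i). Then the binomial x^δ − x^γ belongs to J_V if and only if δ(i) + γ(i) is even for every i ∈ V_G. -/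
open MvPolynomial

/-- The `K`-algebra map from `K[V]` to the group algebra of `(ℤ/2)^V` sending `x_i` to the
`i`-th standard generator. -/
noncomputable def parityMap (V K : Type) [CommRing K] :
    MvPolynomial V K →ₐ[K] AddMonoidAlgebra K (V → ZMod 2) :=
  open Classical in aeval fun i => AddMonoidAlgebra.single (Pi.single i 1) 1

theorem parityMap_X_sq {V K : Type} [CommRing K] (i : V) :
    parityMap V K (X i ^ 2) = 1 := by
  classical
  have h : (2 : ZMod 2) = 0 := by decide
  simp [parityMap, AddMonoidAlgebra.single_pow, ← Pi.single_smul, h, AddMonoidAlgebra.one_def]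

theorem parityMap_monomial {V K : Type} [Fintype V] [CommRing K] (δ : V →₀ ℕ) :
    parityMap V K (monomial δ 1) = AddMonoidAlgebra.single (fun i => (δ i : ZMod 2)) 1 := by
  classical
  have h : ∀ s : Finset V, ∏ i ∈ s,
      (AddMonoidAlgebra.single (δ i • Pi.single i (1 : ZMod 2)) 1 :
        AddMonoidAlgebra K (V → ZMod 2)) =
      AddMonoidAlgebra.single (∑ i ∈ s, δ i • Pi.single i (1 : ZMod 2)) 1 := by
    intro s
    induction s using Finset.induction_on with
    | empty => simp [AddMonoidAlgebra.one_def]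
    | insert a s ha ih =>
      rw [Finset.prod_insert ha, Finset.sum_insert ha, ih, AddMonoidAlgebra.single_mul_single,
        one_mul]
  rw [parityMap, aeval_monomial, map_one, one_mul, Finsupp.prod_fintype _ _ (by simp)]
  simp only [AddMonoidAlgebra.single_pow, one_pow, h]
  congr 1
  ext j
  simp [Finset.sum_apply, Pi.single_apply]

theorem JV_le_ker_parityMap (V K : Type) [CommRing K] :
    JV V K ≤ RingHom.ker (parityMap V K) := by
  refine Ideal.span_le.2 ?_
  rintro _ ⟨i, j, rfl⟩
  simp only [SetLike.mem_coe, RingHom.mem_ker, map_sub, parityMap_X_sq, sub_self]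

/-- Modulo `J_V`, a monomial depends only on the parities of its exponents and on
the number of squares it contains. -/
theorem mk_JV_monomial {V K : Type} [Fintype V] [CommRing K] (δ : V →₀ ℕ) (k : V) :
    Ideal.Quotient.mk (JV V K) (monomial δ 1) =
      (∏ i, Ideal.Quotient.mk (JV V K) (X i) ^ (δ i % 2)) *
        (Ideal.Quotient.mk (JV V K) (X k) ^ 2) ^ ∑ i, δ i / 2 := by
  have h : ∀ i, Ideal.Quotient.mk (JV V K) (X i) ^ 2 =
      Ideal.Quotient.mk (JV V K) (X k) ^ 2 := fun i => by
    rw [← map_pow, ← map_pow, Ideal.Quotient.eq]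
    exact Ideal.subset_span ⟨i, k, rfl⟩
  rw [monomial_eq, map_one, one_mul, Finsupp.prod_fintype _ _ (by simp), map_prod,
    ← Finset.prod_pow_eq_pow_sum, ← Finset.prod_mul_distrib]
  refine Finset.prod_congr rfl fun i _ => ?_
  rw [← h i, ← pow_mul, ← pow_add, Nat.mod_add_div, map_pow]

/-- For `δ, γ ∈ ℕ^V` with equal total degree, the binomial `x^δ - x^γ` belongs to
`J_V` if and only if `δ(i) + γ(i)` is even for every `i ∈ V`. -/
theorem stmt7 {V K : Type} [Finite V] [Nonempty V] [Field K]
    (δ γ : V →₀ ℕ)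
    (hdeg : (δ.sum fun _ m => m) = (γ.sum fun _ m => m)) :
    (monomial δ (1 : K) - monomial γ (1 : K) : MvPolynomial V K) ∈ JV V K ↔
      ∀ i : V, Even (δ i + γ i) := by
  have := Fintype.ofFinite V
  constructor
  · intro h i
    have h0 := JV_le_ker_parityMap V K h
    rw [RingHom.mem_ker, map_sub, sub_eq_zero, parityMap_monomial, parityMap_monomial] at h0
    have h1 := congrFun (AddMonoidAlgebra.single_left_injective one_ne_zero h0) i
    have h2 := (ZMod.natCast_eq_natCast_iff' _ _ 2).1 h1
    rw [Nat.even_iff]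
    omega
  · intro h
    have hmod : ∀ i, δ i % 2 = γ i % 2 := fun i => by
      have := Nat.even_iff.1 (h i)
      omega
    have hdiv : ∑ i, δ i / 2 = ∑ i, γ i / 2 := by
      rw [Finsupp.sum_fintype _ _ (by simp), Finsupp.sum_fintype _ _ (by simp)] at hdeg
      have hsplit : ∀ ε : V →₀ ℕ, ∑ i, ε i = ∑ i, ε i % 2 + 2 * ∑ i, ε i / 2 := fun ε => by
        rw [Finset.mul_sum, ← Finset.sum_add_distrib]
        exact Finset.sum_congr rfl fun i _ => (Nat.mod_add_div _ _).symm
      rw [hsplit δ, hsplit γ, Finset.sum_congr rfl fun i _ => hmod i] at hdeg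
      omega
    obtain ⟨k⟩ := ‹Nonempty V›
    rw [← Ideal.Quotient.eq, mk_JV_monomial δ k, mk_JV_monomial γ k, hdiv]
    simp only [hmod]
end

section
/- Let α, β ∈ ℕ^{E_G} satisfy Σ_e α(e) = Σ_e β(e) and min(α(e), β(e)) = 0 for every e ∈ E_G (i.e., the monomials t^α and t^β are coprime). Then t^α − t^β ∈ I(X_G) if and only if for every vertex v ∈ V_G the number of edges e ∈ E_G incident to v with α(e) + β(e) odd is even. -/
open MvPolynomial

/-- The product of `f` over the two endpoints of an edge. -/
theorem prod_ite_mem_sym2 {V M : Type} [Fintype V] [CommMonoid M] [DecidableEq V] (f : V → M)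
    {i j : V} (h : i ≠ j) : (∏ v, if v ∈ s(i, j) then f v else 1) = f i * f j := by
  rw [← Finset.prod_filter, ← Finset.prod_pair h]
  congr 1
  ext v
  simp

/-- The exponent of `x_v` in the image of `t^α` under `θ`. -/
noncomputable def vertexWeight {V : Type} {G : SimpleGraph V} [Fintype G.edgeSet] [DecidableEq V]
    (α : G.edgeSet →₀ ℕ) (v : V) : ℕ :=
  ∑ e : G.edgeSet, if v ∈ (e : Sym2 V) then α e else 0

section

variable {V : Type} [DecidableEq V] {G : SimpleGraph V} [Fintype G.edgeSet]

theorem even_ncard_iff_even_vertexWeight_add (α β : G.edgeSet →₀ ℕ) (v : V) :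
    Even (Set.ncard {e : G.edgeSet | v ∈ (e : Sym2 V) ∧ Odd (α e + β e)}) ↔
      Even (vertexWeight α v + vertexWeight β v) := by
  classical
  have h : vertexWeight α v + vertexWeight β v =
      ∑ e ∈ Finset.univ.filter fun e : G.edgeSet => v ∈ (e : Sym2 V), (α e + β e) := by
    simp only [vertexWeight, Finset.sum_filter, ← Finset.sum_add_distrib]
    refine Finset.sum_congr rfl fun e _ => ?_
    split_ifs <;> rfl
  rw [h, Finset.even_sum_iff_even_card_odd, Finset.filter_filter, ← Set.ncard_coe_finset]
  simp

variable [Fintype V]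

theorem thetaG_monomial (K : Type) [CommRing K] (α : G.edgeSet →₀ ℕ) :
    thetaG K G (monomial α 1) = ∏ v, X v ^ vertexWeight α v := by
  have key (e : G.edgeSet) : edgePoly K (e : Sym2 V) ^ α e =
      ∏ v, (X v : MvPolynomial V K) ^ (if v ∈ (e : Sym2 V) then α e else 0) := by
    obtain ⟨e, he⟩ := e
    induction e using Sym2.ind with
    | _ i j =>
      have hij : i ≠ j := G.ne_of_adj he
      have := prod_ite_mem_sym2 (fun v => (X v : MvPolynomial V K) ^ α ⟨s(i, j), he⟩) hij
      simp only [pow_ite, pow_zero, this]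
      simp [edgePoly, mul_pow]
  rw [thetaG, aeval_monomial, map_one, one_mul, Finsupp.prod_fintype _ _ (by simp)]
  simp_rw [key, vertexWeight]
  rw [Finset.prod_comm]
  simp_rw [Finset.prod_pow_eq_pow_sum]

theorem sum_vertexWeight (α : G.edgeSet →₀ ℕ) :
    ∑ v, vertexWeight α v = 2 * α.sum fun _ m => m := by
  unfold vertexWeight
  rw [Finset.sum_comm, Finsupp.sum_fintype _ _ (by simp), Finset.mul_sum]
  refine Finset.sum_congr rfl fun e _ => ?_
  obtain ⟨e, he⟩ := e
  induction e using Sym2.ind with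
  | _ i j =>
    have hij : i ≠ j := G.ne_of_adj he
    have := prod_ite_mem_sym2 (fun _ => Multiplicative.ofAdd (α ⟨s(i, j), he⟩)) hij
    rw [two_mul]
    exact this

end

/-- If all `x i` have the same square, a monomial in the `x i` depends only on its degree and on
the parities of its exponents. -/
theorem prod_pow_eq_of_sq_eq {V M : Type} [Fintype V] [CommMonoid M] (x : V → M)
    (hx : ∀ i j, x i ^ 2 = x j ^ 2) {a b : V → ℕ} (hsum : ∑ v, a v = ∑ v, b v)
    (hpar : ∀ v, a v % 2 = b v % 2) : ∏ v, x v ^ a v = ∏ v, x v ^ b v := by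
  obtain ⟨y, hy⟩ : ∃ y, ∀ i, x i ^ 2 = y := by
    cases isEmpty_or_nonempty V with
    | inl _ => exact ⟨1, fun i => isEmptyElim i⟩
    | inr h => exact ⟨x h.some ^ 2, fun i => hx _ _⟩
  have key (c : V → ℕ) : ∏ v, x v ^ c v = (∏ v, x v ^ (c v % 2)) * y ^ ∑ v, c v / 2 := by
    rw [← Finset.prod_pow_eq_pow_sum, ← Finset.prod_mul_distrib]
    refine Finset.prod_congr rfl fun v _ => ?_
    rw [← hy v, ← pow_mul, ← pow_add, Nat.mod_add_div]
  have hdiv (c : V → ℕ) : ∑ v, c v = ∑ v, c v % 2 + 2 * ∑ v, c v / 2 := by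
    rw [Finset.mul_sum, ← Finset.sum_add_distrib]
    exact Finset.sum_congr rfl fun v _ => (Nat.mod_add_div _ _).symm
  have hhalf : ∑ v, a v / 2 = ∑ v, b v / 2 := by
    have ha := hdiv a
    have hb := hdiv b
    simp only [hpar] at ha
    omega
  rw [key a, key b, hhalf]
  simp only [hpar]

theorem prod_pow_sub_prod_pow_mem_JV {V K : Type} [Fintype V] [CommRing K] {a b : V → ℕ}
    (hsum : ∑ v, a v = ∑ v, b v) (hpar : ∀ v, a v % 2 = b v % 2) :
    (∏ v, X v ^ a v - ∏ v, X v ^ b v : MvPolynomial V K) ∈ JV V K := by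
  rw [← Ideal.Quotient.eq, map_prod, map_prod]
  simp only [map_pow]
  refine prod_pow_eq_of_sq_eq _ (fun i j => ?_) hsum hpar
  rw [← map_pow, ← map_pow, Ideal.Quotient.eq]
  exact Ideal.subset_span ⟨i, j, rfl⟩

/-- The grading of `K[V_G]` by parities of exponents detects binomials outside `J_V`. -/
theorem natCast_eq_of_prod_pow_sub_prod_pow_mem_JV {V K : Type} [Fintype V] [CommRing K]
    [Nontrivial K] {a b : V → ℕ}
    (h : (∏ v, X v ^ a v - ∏ v, X v ^ b v : MvPolynomial V K) ∈ JV V K) (v : V) :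
    (a v : ZMod 2) = b v := by
  classical
  let φ : MvPolynomial V K →ₐ[K] AddMonoidAlgebra K (V → ZMod 2) :=
    aeval fun i => AddMonoidAlgebra.single (Pi.single i 1) 1
  have hJ : JV V K ≤ RingHom.ker φ := by
    refine Ideal.span_le.2 ?_
    rintro _ ⟨i, j, rfl⟩
    have h2 (i : V) : 2 • (Pi.single i 1 : V → ZMod 2) = 0 := by
      rw [two_nsmul, ← Pi.single_add, CharTwo.add_self_eq_zero, Pi.single_zero]
    simp [φ, RingHom.mem_ker, AddMonoidAlgebra.single_pow, h2]
  have hφ (c : V → ℕ) : φ (∏ v, X v ^ c v) =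
      AddMonoidAlgebra.single (fun v => (c v : ZMod 2)) 1 := by
    have hc : (fun v => (c v : ZMod 2)) = ∑ v, c v • Pi.single v (1 : ZMod 2) := by
      ext w
      simp [Finset.sum_apply, Pi.single_apply]
    rw [hc, map_prod]
    simp only [map_pow, φ, aeval_X, AddMonoidAlgebra.single_pow, one_pow]
    induction (Finset.univ : Finset V) using Finset.induction_on with
    | empty => rfl
    | insert i s hi ih =>
      rw [Finset.prod_insert hi, Finset.sum_insert hi, ih, AddMonoidAlgebra.single_mul_single,
        one_mul]
  have h0 := hJ h
  rw [RingHom.mem_ker, map_sub, hφ, hφ, sub_eq_zero] at h0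
  exact congrFun ((AddMonoidAlgebra.single_left_inj one_ne_zero).1 h0) v

/-- Characterization of coprime homogeneous binomials in `I(X_G)`:
`t^α - t^β ∈ I(X_G)` iff every vertex `v` meets an even number of edges `e`
with `α(e) + β(e)` odd. -/
theorem stmt8 {V K : Type} [Fintype V] [Field K] (G : SimpleGraph V)
    (hG : ∀ v : V, ∃ w : V, G.Adj v w)
    (α β : G.edgeSet →₀ ℕ)
    (hdeg : (α.sum fun _ m => m) = (β.sum fun _ m => m))
    (hcop : ∀ e : G.edgeSet, min (α e) (β e) = 0) :
    (monomial α (1 : K) - monomial β (1 : K) : MvPolynomial G.edgeSet K) ∈ IX K G ↔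
      ∀ v : V,
        Even (Set.ncard {e : G.edgeSet | v ∈ (e : Sym2 V) ∧ Odd (α e + β e)}) := by
  classical
  have hsum : ∑ v, vertexWeight α v = ∑ v, vertexWeight β v := by
    rw [sum_vertexWeight, sum_vertexWeight, hdeg]
  simp only [IX, Ideal.mem_comap, map_sub, thetaG_monomial, even_ncard_iff_even_vertexWeight_add]
  constructor
  · intro h v
    have hv := natCast_eq_of_prod_pow_sub_prod_pow_mem_JV h v
    rw [← ZMod.natCast_eq_zero_iff_even, Nat.cast_add, hv, CharTwo.add_self_eq_zero]
  · intro h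
    refine prod_pow_sub_prod_pow_mem_JV hsum fun v => ?_
    have hv := h v
    rw [Nat.even_iff] at hv
    omega
end

section
/- If e and f are two distinct edges of G, then t_e − t_f ∉ I(X_G). -/
open MvPolynomial

/-- No squarefree monomial of degree two occurs in a polynomial of `J_V`. -/
theorem coeff_eq_zero_of_mem_JV {V K : Type} [CommRing K] {p : MvPolynomial V K}
    (hp : p ∈ JV V K) {a b : V} (hab : a ≠ b) :
    coeff (Finsupp.single a 1 + Finsupp.single b 1) p = 0 := by
  classical
  have hle : JV V K ≤ Ideal.span ((fun s => monomial s (1 : K)) ''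
      Set.range fun i : V => Finsupp.single i 2) := by
    refine Ideal.span_le.2 ?_
    rintro _ ⟨i, j, rfl⟩
    have hsq (k : V) : (X k ^ 2 : MvPolynomial V K) ∈ Ideal.span
        ((fun s => monomial s (1 : K)) '' Set.range fun i : V => Finsupp.single i 2) :=
      Ideal.subset_span ⟨_, ⟨k, rfl⟩, X_pow_eq_monomial.symm⟩
    exact Ideal.sub_mem _ (hsq i) (hsq j)
  by_contra h
  obtain ⟨_, ⟨i, rfl⟩, hi⟩ :=
    mem_ideal_span_monomial_image.1 (hle hp) _ (mem_support_iff.2 h)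
  have h2 := hi i
  simp only [Finsupp.add_apply, Finsupp.single_apply] at h2
  grind

/-- If `e ≠ f` are two distinct edges of `G`, then `t_e - t_f ∉ I(X_G)`. -/
theorem stmt9 {V K : Type} [Field K] (G : SimpleGraph V)
    (hG : ∀ v : V, ∃ w : V, G.Adj v w)
    (e f : G.edgeSet) (hef : e ≠ f) :
    (X e : MvPolynomial G.edgeSet K) - X f ∉ IX K G := by
  classical
  obtain ⟨e, he⟩ := e
  obtain ⟨f, hf⟩ := f
  induction e using Sym2.ind with | _ a b
  induction f using Sym2.ind with | _ c d
  intro hmem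
  have hJ : (X a * X b - X c * X d : MvPolynomial V K) ∈ JV V K := by
    simpa [IX, thetaG, edgePoly] using hmem
  have hab : a ≠ b := G.ne_of_adj he
  have h0 := coeff_eq_zero_of_mem_JV hJ hab
  have hX (i j : V) : (X i * X j : MvPolynomial V K) =
      monomial (Finsupp.single i 1 + Finsupp.single j 1) 1 := by
    simp [X, monomial_mul]
  rw [hX, hX, coeff_sub, coeff_monomial, coeff_monomial, if_pos rfl] at h0
  split_ifs at h0 with h
  · rw [Finsupp.single_add_single_eq_single_add_single one_ne_zero one_ne_zero] at h
    apply hef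
    simp only [Subtype.mk.injEq, Sym2.eq_iff]
    grind
  · simp at h0
end

section
/- Let H be a subgraph of G without isolated vertices, and regard K[E_H] as a subring of K[E_G] via the inclusion of the variables t_e (e ∈ E_H). Then I(X_H) = I(X_G) ∩ K[E_H]; equivalently, the preimage of I(X_G) under the inclusion K[E_H] → K[E_G] equals I(X_H). -/
open MvPolynomial

/-- Folding the variables outside `S` onto an element of `S` (or killing them, when `S` is empty)
fixes the variables in `S` and maps `JV V K` into the ideal generated by the differences of
squares of the variables in `S`. -/
lemma exists_algHom_fixing_map_JV_le {V : Type} (K : Type) [CommRing K] (S : Set V) :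
    ∃ φ : MvPolynomial V K →ₐ[K] MvPolynomial V K, (∀ i ∈ S, φ (X i) = X i) ∧
      JV V K ≤ Ideal.comap φ (Ideal.span
        {f | ∃ i ∈ S, ∃ j ∈ S, f = (X i : MvPolynomial V K) ^ 2 - X j ^ 2}) := by
  classical
  rcases S.eq_empty_or_nonempty with rfl | ⟨k, hk⟩
  · refine ⟨aeval 0, by simp, Ideal.span_le.2 ?_⟩
    rintro _ ⟨i, j, rfl⟩
    simp
  · refine ⟨rename fun i => if i ∈ S then i else k, fun i hi => by simp [hi], Ideal.span_le.2 ?_⟩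
    have hmem (i : V) : (if i ∈ S then i else k) ∈ S := by split_ifs <;> assumption
    rintro _ ⟨i, j, rfl⟩
    simp only [SetLike.mem_coe, Ideal.mem_comap, map_sub, map_pow, rename_X]
    exact Ideal.subset_span ⟨_, hmem i, _, hmem j, rfl⟩

/-- The edge polynomial of an edge of `H` is fixed by any algebra map fixing the variables in
the support of `H`. -/
lemma map_edgePoly_of_fixes_support {V K : Type} [CommRing K] {H : SimpleGraph V}
    {φ : MvPolynomial V K →ₐ[K] MvPolynomial V K} (hφ : ∀ i ∈ H.support, φ (X i) = X i)
    {e : Sym2 V} (he : e ∈ H.edgeSet) : φ (edgePoly K e) = edgePoly K e := by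
  induction e using Sym2.ind with
  | _ i j =>
    have hij : H.Adj i j := he
    simp [edgePoly, hφ i ⟨j, hij⟩, hφ j ⟨i, hij.symm⟩]

/-- For a subgraph `H ≤ G` (with vertex set its support, since `H` has no isolated
vertices), regarding `K[E_H]` as a subring of `K[E_G]` via inclusion of variables,
one has `I(X_H) = I(X_G) ∩ K[E_H]`, i.e. `I(X_H)` is the preimage of `I(X_G)` under
the inclusion `K[E_H] → K[E_G]`. Here `I(X_H)` is defined from `H` in the same way:
it is the preimage under `θ_H` of the ideal generated by
`{x_i² - x_j² : i, j ∈ V_H}` where `V_H = H.support`. -/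
theorem stmt10 {V K : Type} [Field K] (G H : SimpleGraph V)
    (hG : ∀ v : V, ∃ w : V, G.Adj v w) (hle : H ≤ G)
    (θH : MvPolynomial H.edgeSet K →ₐ[K] MvPolynomial V K)
    (hθH : θH = aeval fun e : H.edgeSet => edgePoly K (e : Sym2 V))
    (JH : Ideal (MvPolynomial V K))
    (hJH : JH = Ideal.span
      {f | ∃ i ∈ H.support, ∃ j ∈ H.support, f = (X i : MvPolynomial V K) ^ 2 - X j ^ 2}) :
    Ideal.comap θH JH =
      Ideal.comap
        (rename (Set.inclusion (SimpleGraph.edgeSet_mono hle)) :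
          MvPolynomial H.edgeSet K →ₐ[K] MvPolynomial G.edgeSet K) (IX K G) := by
  subst hθH hJH
  obtain ⟨φ, hφ, hJ⟩ := exists_algHom_fixing_map_JV_le K H.support
  have hcomp (f : MvPolynomial H.edgeSet K) :
      thetaG K G (rename (Set.inclusion (SimpleGraph.edgeSet_mono hle)) f) =
        aeval (fun e : H.edgeSet => edgePoly K (e : Sym2 V)) f := by
    rw [thetaG, aeval_rename]
    rfl
  have hfix (f : MvPolynomial H.edgeSet K) :
      φ (aeval (fun e : H.edgeSet => edgePoly K (e : Sym2 V)) f) =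
        aeval (fun e : H.edgeSet => edgePoly K (e : Sym2 V)) f := by
    rw [comp_aeval_apply]
    exact congrArg (fun g => aeval g f) (funext fun e => map_edgePoly_of_fixes_support hφ e.2)
  ext f
  simp only [IX, Ideal.mem_comap, hcomp]
  refine ⟨fun h => ?_, fun h => hfix f ▸ hJ h⟩
  refine Ideal.span_mono ?_ h
  rintro _ ⟨i, -, j, -, rfl⟩
  exact ⟨i, j, rfl⟩
end

section
/- Let K = ℤ/3ℤ (the field with three elements) and let f ∈ K[E_G] be a homogeneous polynomial. Then f ∈ I(X_G) if and only if θ(f) vanishes at every point of the torus, i.e., for every x : V_G → K with x(i) ≠ 0 for all i ∈ V_G, the evaluation of θ(f) at x equals 0. -/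
open MvPolynomial

/-- Multiplying by a homogeneous polynomial of degree `i` shifts homogeneous components by `i`. -/
theorem homogeneousComponent_mul_add_of_isHomogeneous {σ R : Type*} [CommRing R]
    {p : MvPolynomial σ R} {i : ℕ} (hp : p.IsHomogeneous i) (q : MvPolynomial σ R) (j : ℕ) :
    homogeneousComponent (i + j) (p * q) = p * homogeneousComponent j q := by
  let : GradedAlgebra (homogeneousSubmodule σ R) := gradedAlgebra
  have h := DirectSum.coe_decompose_mul_add_of_left_mem (homogeneousSubmodule σ R)
    (i := i) (j := j) (a := p) (b := q) hp
  rwa [← decomposition.decompose'_apply, ← decomposition.decompose'_apply]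

/-- Multiplying by a homogeneous polynomial of degree `i` kills homogeneous components below `i`. -/
theorem homogeneousComponent_mul_eq_zero_of_lt {σ R : Type*} [CommRing R]
    {p : MvPolynomial σ R} {i n : ℕ} (hp : p.IsHomogeneous i) (q : MvPolynomial σ R)
    (hn : n < i) : homogeneousComponent n (p * q) = 0 := by
  let : GradedAlgebra (homogeneousSubmodule σ R) := gradedAlgebra
  have h := DirectSum.coe_decompose_mul_of_left_mem_of_not_le (homogeneousSubmodule σ R)
    (a := p) (b := q) hp (not_le.mpr hn)
  rwa [← decomposition.decompose'_apply]

theorem edgePoly_isHomogeneous {V K : Type} [CommRing K] (e : Sym2 V) :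
    (edgePoly K e).IsHomogeneous 2 := by
  induction e with
  | _ i j => exact (isHomogeneous_X K i).mul (isHomogeneous_X K j)

theorem thetaG_isHomogeneous {V K : Type} [CommRing K] (G : SimpleGraph V)
    {f : MvPolynomial G.edgeSet K} {d : ℕ} (hf : f.IsHomogeneous d) :
    (thetaG K G f).IsHomogeneous (2 * d) :=
  hf.aeval _ fun e => edgePoly_isHomogeneous (e : Sym2 V)

theorem sum_X_sq_mul_sub_mem_JV {V K : Type} [Fintype V] [CommRing K] (v : V)
    (q : V → MvPolynomial V K) :
    ∑ i, X i ^ 2 * q i - X v ^ 2 * ∑ i, q i ∈ JV V K := by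
  rw [Finset.mul_sum, ← Finset.sum_sub_distrib]
  refine Ideal.sum_mem _ fun i _ => ?_
  rw [← sub_mul]
  exact Ideal.mul_mem_right _ _ (Ideal.subset_span ⟨i, v, rfl⟩)

/-- A homogeneous polynomial of degree `n` in the ideal `(x_i² - 1)`, with cofactors of
degree less than `n`, lies in the ideal `(x_i² - x_j²)`. -/
theorem mem_JV_of_eq_sum_X_sq_sub_one_mul {V K : Type} [Fintype V] [CommRing K]
    {g : MvPolynomial V K} {n : ℕ} (hg : g.IsHomogeneous n) (h : V → MvPolynomial V K)
    (hh : ∀ i, homogeneousComponent n (h i) = 0)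
    (hgh : g = ∑ i, (X i ^ 2 - 1) * h i) : g ∈ JV V K := by
  rcases isEmpty_or_nonempty V with hV | ⟨⟨v⟩⟩
  · simp [hgh]
  have component (k : ℕ) : homogeneousComponent k g =
      ∑ i, homogeneousComponent k (X i ^ 2 * h i) - ∑ i, homogeneousComponent k (h i) := by
    rw [hgh, map_sum, ← Finset.sum_sub_distrib]
    exact Finset.sum_congr rfl fun i _ => by rw [sub_mul, one_mul, map_sub]
  have hX (i : V) : (X i ^ 2 : MvPolynomial V K).IsHomogeneous 2 := isHomogeneous_X_pow i 2
  have shifted (k : ℕ) (hk : ∀ m, m + 2 = k → ∑ i, homogeneousComponent m (h i) ∈ JV V K) :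
      ∑ i, homogeneousComponent k (X i ^ 2 * h i) ∈ JV V K := by
    rcases lt_or_ge k 2 with hk2 | hk2
    · rw [Finset.sum_eq_zero fun i _ => homogeneousComponent_mul_eq_zero_of_lt (hX i) (h i) hk2]
      exact Ideal.zero_mem _
    · obtain ⟨m, rfl⟩ := Nat.exists_eq_add_of_le hk2
      simp_rw [homogeneousComponent_mul_add_of_isHomogeneous (hX _)]
      exact (Submodule.sub_mem_iff_left _
        (Ideal.mul_mem_left _ (X v ^ 2) (hk m (add_comm _ _)))).mp (sum_X_sq_mul_sub_mem_JV v _)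
  have cofactors (k : ℕ) (hk : k < n) : ∑ i, homogeneousComponent k (h i) ∈ JV V K := by
    induction k using Nat.strong_induction_on with
    | _ k ih =>
      have hzero : homogeneousComponent k g = 0 := by
        rw [homogeneousComponent_of_mem hg, if_neg hk.ne]
      rw [← sub_eq_zero.mp ((component k).symm.trans hzero)]
      exact shifted k fun m hm => ih m (by omega) (by omega)
  have hself : homogeneousComponent n g = g := by
    rw [homogeneousComponent_of_mem hg, if_pos rfl]
  rw [← hself, component, Finset.sum_eq_zero fun i _ => hh i, sub_zero]
  exact shifted n fun m hm => cofactors m (by omega)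

theorem totalDegree_X_sq_sub_one_pos {V K : Type} [CommRing K] [Nontrivial K] (i : V) :
    0 < (X i ^ 2 - 1 : MvPolynomial V K).totalDegree := by
  classical
  have hmem : Finsupp.single i 2 ∈ (X i ^ 2 - 1 : MvPolynomial V K).support := by
    have hne : (0 : V →₀ ℕ) ≠ Finsupp.single i 2 := by simp [eq_comm]
    simp [mem_support_iff, coeff_X_pow, coeff_one, hne]
  have := le_totalDegree hmem
  simp only [Finsupp.sum_single_index] at this
  omega

/-- A homogeneous polynomial over a domain of characteristic different from `2` that vanishes
on `{1, -1}^V` lies in the ideal `(x_i² - x_j²)`. -/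
theorem mem_JV_of_eval_eq_zero {V K : Type} [Fintype V] [CommRing K] [IsDomain K]
    (hK : (1 : K) ≠ -1) {g : MvPolynomial V K} {n : ℕ} (hg : g.IsHomogeneous n)
    (heval : ∀ x : V → K, (∀ i, x i = 1 ∨ x i = -1) → eval x g = 0) : g ∈ JV V K := by
  classical
  obtain ⟨h, hdeg, hgh⟩ := combinatorial_nullstellensatz_exists_linearCombination
    (fun _ : V => ({1, -1} : Finset K)) (fun _ => by simp) g
    (fun x hx => heval x fun i => by simpa using hx i)
  have hprod (i : V) :
      ∏ r ∈ ({1, -1} : Finset K), (X i - C r : MvPolynomial V K) = X i ^ 2 - 1 := by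
    rw [Finset.prod_pair hK, map_neg, map_one]
    ring
  simp only [hprod] at hdeg hgh
  refine mem_JV_of_eq_sum_X_sq_sub_one_mul hg h (fun i => ?_) ?_
  · by_cases hi : h i = 0
    · rw [hi, map_zero]
    have hpos := totalDegree_X_sq_sub_one_pos (K := K) i
    have hP : (X i ^ 2 - 1 : MvPolynomial V K) ≠ 0 := by
      intro h0
      simp [h0] at hpos
    have hle := (hdeg i).trans hg.totalDegree_le
    rw [totalDegree_mul_of_isDomain hP hi] at hle
    exact homogeneousComponent_eq_zero _ _ (by omega)
  · rw [hgh, Finsupp.linearCombination_apply, Finsupp.sum_fintype _ _ (by simp)]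
    exact Finset.sum_congr rfl fun i _ => by rw [smul_eq_mul, mul_comm]

theorem eval_eq_zero_of_mem_JV {V K : Type} [CommRing K] {g : MvPolynomial V K}
    (hg : g ∈ JV V K) {x : V → K} (hx : ∀ i, x i ^ 2 = 1) : eval x g = 0 := by
  have hle : JV V K ≤ RingHom.ker (eval x) := by
    refine Ideal.span_le.mpr ?_
    rintro _ ⟨i, j, rfl⟩
    simp [RingHom.mem_ker, hx]
  exact hle hg

/-- Over `K = ℤ/3ℤ`, a homogeneous polynomial `f ∈ K[E_G]` lies in `I(X_G)` if and
only if `θ(f)` vanishes at every point of the torus `{x : V → K | ∀ i, x i ≠ 0}`. -/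
theorem stmt11 {V : Type} [Fintype V] (G : SimpleGraph V)
    (hG : ∀ v : V, ∃ w : V, G.Adj v w)
    (f : MvPolynomial G.edgeSet (ZMod 3)) (d : ℕ) (hf : f.IsHomogeneous d) :
    f ∈ IX (ZMod 3) G ↔
      ∀ x : V → ZMod 3, (∀ i : V, x i ≠ 0) → eval x (thetaG (ZMod 3) G f) = 0 := by
  constructor
  · intro hmem x hx
    have sq_eq_one : ∀ a : ZMod 3, a ≠ 0 → a ^ 2 = 1 := by decide
    exact eval_eq_zero_of_mem_JV hmem fun i => sq_eq_one _ (hx i)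
  · intro heval
    refine mem_JV_of_eval_eq_zero (by decide) (thetaG_isHomogeneous G hf) fun x hx => ?_
    refine heval x fun i => ?_
    rcases hx i with h | h <;> rw [h] <;> decide
end

section
/- For all α, δ ∈ ℕ^{E_G}, the monomial t^α belongs to the ideal I(X_G) + (t^δ) if and only if there exists β ∈ ℕ^{E_G} such that Σ_e β(e) = Σ_e α(e), the binomial t^α − t^β belongs to I(X_G), and δ(e) ≤ β(e) for every e ∈ E_G (i.e., t^δ divides t^β). -/
open MvPolynomial

/-- The exponent vector of `edgePoly K e`. -/
noncomputable def edgeExponent {V : Type} (e : Sym2 V) : V →₀ ℕ :=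
  Sym2.lift ⟨fun i j => Finsupp.single i 1 + Finsupp.single j 1, fun _ _ => add_comm _ _⟩ e

theorem edgePoly_eq_monomial {V K : Type} [CommRing K] (e : Sym2 V) :
    edgePoly K e = monomial (edgeExponent e) 1 := by
  induction e with
  | _ i j => simp [edgePoly, edgeExponent, X, monomial_mul]

theorem degree_edgeExponent {V : Type} (e : Sym2 V) : (edgeExponent e).degree = 2 := by
  induction e with
  | _ i j => simp [edgeExponent]

/-- `θ` sends a monomial to a monomial of twice the degree. -/
theorem exists_thetaG_monomial {V : Type} (K : Type) [CommRing K] (G : SimpleGraph V)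
    (γ : G.edgeSet →₀ ℕ) :
    ∃ u : V →₀ ℕ, thetaG K G (monomial γ 1) = monomial u 1 ∧ u.degree = 2 * γ.degree := by
  induction γ using Finsupp.induction_linear with
  | zero => exact ⟨0, by simp, by simp⟩
  | add f g hf hg =>
    obtain ⟨u, hu, hud⟩ := hf
    obtain ⟨v, hv, hvd⟩ := hg
    refine ⟨u + v, ?_, by simp [hud, hvd, mul_add]⟩
    rw [← one_mul (1 : K), ← monomial_mul, map_mul, hu, hv, monomial_mul]
  | single e n =>
    refine ⟨n • edgeExponent (e : Sym2 V), ?_, by simp [degree_edgeExponent, mul_comm]⟩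
    rw [← one_pow n, ← monomial_pow, one_pow, ← edgePoly_eq_monomial, ← X_pow_eq_monomial,
      map_pow, thetaG, aeval_X]

/-- The degree of an exponent vector together with the parities of its entries. -/
noncomputable def degreeParity (V : Type) : (V →₀ ℕ) →+ ℕ × (V → ZMod 2) where
  toFun u := (u.degree, fun i => (u i : ZMod 2))
  map_zero' := by ext <;> simp
  map_add' u v := by ext <;> simp

/-- The grading of `K[V_G]` by `degreeParity`, as a map to the monoid algebra. -/
noncomputable def toDegreeParity (V K : Type) [CommRing K] :
    MvPolynomial V K →ₐ[K] AddMonoidAlgebra K (ℕ × (V → ZMod 2)) :=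
  aeval fun i => AddMonoidAlgebra.single (degreeParity V (Finsupp.single i 1)) 1

theorem toDegreeParity_monomial {V K : Type} [CommRing K] (u : V →₀ ℕ) :
    toDegreeParity V K (monomial u 1) = AddMonoidAlgebra.single (degreeParity V u) 1 := by
  induction u using Finsupp.induction_linear with
  | zero => rw [monomial_zero', map_one, map_one, map_zero, AddMonoidAlgebra.one_def]
  | add f g hf hg =>
    rw [← one_mul (1 : K), ← monomial_mul, map_mul, hf, hg, AddMonoidAlgebra.single_mul_single,
      map_add]
  | single i n =>
    rw [toDegreeParity, aeval_monomial, map_one, one_mul,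
      Finsupp.prod_single_index (h := fun _ k => _ ^ k) (pow_zero _),
      AddMonoidAlgebra.single_pow, ← map_nsmul]
    simp

theorem toDegreeParity_eq_zero {V K : Type} [CommRing K] {f : MvPolynomial V K}
    (hf : f ∈ JV V K) : toDegreeParity V K f = 0 := by
  have hle : JV V K ≤ RingHom.ker (toDegreeParity V K) := by
    refine Ideal.span_le.2 ?_
    rintro _ ⟨i, j, rfl⟩
    have key (k : V) : degreeParity V (Finsupp.single k 2) = (2, 0) := by
      refine Prod.ext (by simp [degreeParity]) (funext fun l => ?_)
      by_cases h : k = l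
      · subst h
        simpa [degreeParity] using (by decide : (2 : ZMod 2) = 0)
      · simp [degreeParity, h]
    simp only [SetLike.mem_coe, RingHom.mem_ker, map_sub, X_pow_eq_monomial,
      toDegreeParity_monomial, key, sub_self]
  exact hle hf

theorem monomial_sub_monomial_mem_JV {V K : Type} [CommRing K] {u v : V →₀ ℕ}
    (h : degreeParity V u = degreeParity V v) :
    monomial u (1 : K) - monomial v 1 ∈ JV V K := by
  have hdeg : u.degree = v.degree := congrArg Prod.fst h
  have hpar (i : V) : u i % 2 = v i % 2 :=
    (ZMod.natCast_eq_natCast_iff' _ _ 2).1 (congrFun (congrArg Prod.snd h) i)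
  rcases isEmpty_or_nonempty V with hV | ⟨⟨o⟩⟩
  · simp [Subsingleton.elim u v]
  set q := Ideal.Quotient.mk (JV V K)
  have hsq (i : V) : q (X i) ^ 2 = q (X o) ^ 2 := by
    rw [← map_pow, ← map_pow]
    exact Ideal.Quotient.eq.2 (Ideal.subset_span ⟨i, o, rfl⟩)
  have hdouble (a : V →₀ ℕ) : q (monomial (2 • a) 1) = (q (X o) ^ 2) ^ a.degree := by
    induction a using Finsupp.induction_linear with
    | zero => simp
    | add f g hf hg =>
      rw [smul_add, ← one_mul (1 : K), ← monomial_mul, map_mul, hf, hg, map_add, pow_add]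
    | single i n =>
      rw [Finsupp.smul_single, smul_eq_mul, ← X_pow_eq_monomial, pow_mul, map_pow, map_pow, hsq,
        Finsupp.degree_single]
  let half (w : V →₀ ℕ) : V →₀ ℕ := w.mapRange (· / 2) (by simp)
  let rem (w : V →₀ ℕ) : V →₀ ℕ := w.mapRange (· % 2) (by simp)
  have hsplit (w : V →₀ ℕ) : w = 2 • half w + rem w := by
    ext i
    simp [half, rem, Nat.div_add_mod]
  have hrem : rem u = rem v := by
    ext i
    simp [rem, hpar]
  have hhalf : (half u).degree = (half v).degree := by
    have hu := congrArg Finsupp.degree (hsplit u)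
    have hv := congrArg Finsupp.degree (hsplit v)
    rw [map_add, map_nsmul, smul_eq_mul] at hu hv
    rw [hrem] at hu
    lia
  have hq (w : V →₀ ℕ) :
      q (monomial w 1) = (q (X o) ^ 2) ^ (half w).degree * q (monomial (rem w) 1) := by
    conv_lhs => rw [hsplit w, ← one_mul (1 : K), ← monomial_mul, map_mul, hdouble]
  refine Ideal.Quotient.eq.1 ?_
  change q _ = q _
  rw [hq u, hq v, hrem, hhalf]

/-- `t^α ∈ I(X_G) + (t^δ)` iff there is `β` of the same total degree as `α` with
`t^α - t^β ∈ I(X_G)` and `t^δ ∣ t^β`. -/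
theorem stmt12 {V K : Type} [Fintype V] [Field K] (G : SimpleGraph V)
    (hG : ∀ v : V, ∃ w : V, G.Adj v w)
    (α δ : G.edgeSet →₀ ℕ) :
    (monomial α (1 : K) : MvPolynomial G.edgeSet K) ∈
        IX K G ⊔ Ideal.span {monomial δ (1 : K)} ↔
      ∃ β : G.edgeSet →₀ ℕ,
        (β.sum fun _ m => m) = (α.sum fun _ m => m) ∧
        monomial α (1 : K) - monomial β (1 : K) ∈ IX K G ∧
        δ ≤ β := by
  constructor
  · intro h
    obtain ⟨f, hf, g, hg, hfg⟩ := Submodule.mem_sup.1 h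
    obtain ⟨a, rfl⟩ := Ideal.mem_span_singleton'.1 hg
    choose N hN hNdeg using exists_thetaG_monomial K G
    let Ψ := (toDegreeParity V K).comp (thetaG K G)
    have hΨ (γ : G.edgeSet →₀ ℕ) :
        Ψ (monomial γ 1) = AddMonoidAlgebra.single (degreeParity V (N γ)) 1 := by
      simp only [Ψ, AlgHom.comp_apply, hN, toDegreeParity_monomial]
    have hα : Ψ (monomial α 1) = Ψ (a * monomial δ 1) := by
      have hf0 : Ψ f = 0 := toDegreeParity_eq_zero hf
      rw [← hfg, map_add, hf0, zero_add]
    obtain ⟨γ, hγ⟩ : ∃ γ, degreeParity V (N (γ + δ)) = degreeParity V (N α) := by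
      by_contra! hne
      have hzero (b : MvPolynomial G.edgeSet K) :
          (Ψ (b * monomial δ 1)).coeff (degreeParity V (N α)) = 0 := by
        induction b using MvPolynomial.induction_on' with
        | monomial γ c =>
          rw [monomial_mul, mul_one, ← mul_one c, ← smul_eq_mul, ← smul_monomial, map_smul, hΨ]
          simp [hne γ]
        | add p q hp hq =>
          rw [add_mul, map_add, AddMonoidAlgebra.coeff_add, Finsupp.add_apply, hp, hq, add_zero]
      have := hzero a
      rw [← hα, hΨ] at this
      simp at this
    refine ⟨γ + δ, ?_, ?_, le_add_self⟩
    · have hdeg : (N (γ + δ)).degree = (N α).degree := congrArg Prod.fst hγ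
      rw [hNdeg, hNdeg] at hdeg
      exact Nat.eq_of_mul_eq_mul_left two_pos hdeg
    · rw [IX, Ideal.mem_comap, map_sub, hN, hN]
      exact monomial_sub_monomial_mem_JV hγ.symm
  · rintro ⟨β, -, hβ, hδ⟩
    rw [← sub_add_cancel (monomial α (1 : K)) (monomial β 1)]
    refine Submodule.add_mem_sup hβ (Ideal.mem_span_singleton.2 ?_)
    exact monomial_dvd_monomial.2 ⟨Or.inr hδ, dvd_rfl⟩
end
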